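/- A Z^n-module N is finitely determined if and only if it admits a finite flange presentation: a homomorphism φ : F → E of Z^n-modules whose image is isomorphic to N, where F is a finite direct sum of upset modules of the form k[a + Zτ′ + N^n] and E is a finite direct sum of downset modules of the form k[b + Zτ − N^n], with a, b ∈ Z^n and τ′, τ faces of N^n. -/

import Mathlib

/-- The component of the indicator module `k[S]` in degree `q`: the field `k`
(as the full submodule of itself) if `q ∈ S`, and `0` otherwise. -/
noncomputable def cmpt (k : Type) [Field k] {Q : Type} (S : Set Q) (q : Q) : Submodule k k :=
  haveI := Classical.dec (q ∈ S)
  if q ∈ S then ⊤ else ⊥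

/-- The structure map of the indicator module `k[S]` for `q ≤ q'`:
the identity of `k` when `q, q' ∈ S`, and `0` otherwise. -/
noncomputable def stMap (k : Type) [Field k] {Q : Type} [PartialOrder Q] (S : Set Q)
    {q q' : Q} (h : q ≤ q') : ↥(cmpt k S q) →ₗ[k] ↥(cmpt k S q') :=
  haveI := Classical.dec (q ∈ S ∧ q' ∈ S)
  if hq : q ∈ S ∧ q' ∈ S then
    Submodule.inclusion (by simp [cmpt, hq.1, hq.2])
  else 0

/-- The space of `Q`-module homomorphisms `k[S] → k[T]` between indicator modules:
families of linear maps in each degree commuting with the structure maps. -/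
noncomputable def HomQ (k : Type) [Field k] {Q : Type} [PartialOrder Q] (S T : Set Q) :
    Submodule k (∀ q : Q, ↥(cmpt k S q) →ₗ[k] ↥(cmpt k T q)) where
  carrier := {φ | ∀ (q q' : Q) (h : q ≤ q'), stMap k T h ∘ₗ φ q = φ q' ∘ₗ stMap k S h}
  add_mem' := by
    intro a b ha hb
    simp only [Set.mem_setOf_eq] at ha hb ⊢
    intro q q' h
    ext x
    have ha' := congrArg (fun g => g x) (ha q q' h)
    have hb' := congrArg (fun g => g x) (hb q q' h)
    simp only [LinearMap.comp_apply] at ha' hb' ⊢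
    simp only [Pi.add_apply, LinearMap.add_apply, map_add, ha', hb']
  zero_mem' := by
    simp only [Set.mem_setOf_eq]
    intro q q' h
    ext x
    simp
  smul_mem' := by
    intro c a ha
    simp only [Set.mem_setOf_eq] at ha ⊢
    intro q q' h
    ext x
    have ha' := congrArg (fun g => g x) (ha q q' h)
    simp only [LinearMap.comp_apply] at ha' ⊢
    simp only [Pi.smul_apply, LinearMap.smul_apply, map_smul, ha']

/-- The scalar by which a homomorphism of indicator modules acts in degree `q`. -/
noncomputable def scl {k : Type} [Field k] {Q : Type} {S T : Set Q}
    (φ : ∀ q : Q, ↥(cmpt k S q) →ₗ[k] ↥(cmpt k T q)) (q : Q) (hq : q ∈ S) : k :=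
  (φ q ⟨1, by simp [cmpt, hq]⟩ : ↥(cmpt k T q)).1

/-- The set of connected components of a subset `S` of a poset: the quotient of `S`
by the equivalence relation generated by comparability (zigzag paths within `S`). -/
def Pi0 {Q : Type} [PartialOrder Q] (S : Set Q) : Type :=
  Quot (fun a b : S => (a : Q) ≤ (b : Q))

open Pointwise

/-- `ℤτ ⊆ ℤⁿ`: the subgroup generated by the standard basis vectors indexed by the face
`τ ⊆ {1, …, n}`. -/
def ZTau (n : ℕ) (τ : Set (Fin n)) : Set (Fin n → ℤ) := {z | ∀ i, i ∉ τ → z i = 0}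

/-- `ℕⁿ ⊆ ℤⁿ`: the positive cone of componentwise nonnegative vectors. -/
def NNn (n : ℕ) : Set (Fin n → ℤ) := {m | 0 ≤ m}

/-- The upset `a + ℤτ' + ℕⁿ` of `ℤⁿ`. -/
def upFlat {n : ℕ} (a : Fin n → ℤ) (τ' : Set (Fin n)) : Set (Fin n → ℤ) :=
  ({a} : Set (Fin n → ℤ)) + ZTau n τ' + NNn n

/-- The downset `b + ℤτ − ℕⁿ` of `ℤⁿ`. -/
def downInj {n : ℕ} (b : Fin n → ℤ) (τ : Set (Fin n)) : Set (Fin n → ℤ) :=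
  ({b} : Set (Fin n → ℤ)) + ZTau n τ - NNn n

/-- Degree-`q` component of a finite direct sum of upset modules `k[a p + ℤ(τ' p) + ℕⁿ]`. -/
noncomputable abbrev FSum (k : Type) [Field k] {n : ℕ} (m : ℕ)
    (a : Fin m → (Fin n → ℤ)) (τ' : Fin m → Set (Fin n)) (q : Fin n → ℤ) : Type :=
  ∀ p : Fin m, ↥(cmpt k (upFlat (a p) (τ' p)) q)

/-- Degree-`q` component of a finite direct sum of downset modules `k[b j + ℤ(τ j) − ℕⁿ]`. -/
noncomputable abbrev ESum (k : Type) [Field k] {n : ℕ} (m : ℕ)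
    (b : Fin m → (Fin n → ℤ)) (τ : Fin m → Set (Fin n)) (q : Fin n → ℤ) : Type :=
  ∀ j : Fin m, ↥(cmpt k (downInj (b j) (τ j)) q)

/-- Structure map of a finite direct sum of upset modules. -/
noncomputable def FSumMap (k : Type) [Field k] {n : ℕ} (m : ℕ)
    (a : Fin m → (Fin n → ℤ)) (τ' : Fin m → Set (Fin n))
    {q q' : Fin n → ℤ} (h : q ≤ q') : FSum k m a τ' q →ₗ[k] FSum k m a τ' q' :=
  LinearMap.pi fun p => (stMap k (upFlat (a p) (τ' p)) h) ∘ₗ LinearMap.proj p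

/-- Structure map of a finite direct sum of downset modules. -/
noncomputable def ESumMap (k : Type) [Field k] {n : ℕ} (m : ℕ)
    (b : Fin m → (Fin n → ℤ)) (τ : Fin m → Set (Fin n))
    {q q' : Fin n → ℤ} (h : q ≤ q') : ESum k m b τ q →ₗ[k] ESum k m b τ q' :=
  LinearMap.pi fun j => (stMap k (downInj (b j) (τ j)) h) ∘ₗ LinearMap.proj j

/-- A `ℤⁿ`-module `N` is finitely determined if its components are finite-dimensional and
for each coordinate `i` the structure maps `N_b → N_{b + eᵢ}` are isomorphisms whenever
the `i`-th coordinate of `b` lies outside a bounded interval. -/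
def FinDet (k : Type) [Field k] {n : ℕ}
    (N : (Fin n → ℤ) → Type) [∀ a, AddCommGroup (N a)] [∀ a, Module k (N a)]
    (f : ∀ {a b : Fin n → ℤ}, a ≤ b → (N a →ₗ[k] N b)) : Prop :=
  (∀ a, FiniteDimensional k (N a)) ∧
  ∀ i : Fin n, ∃ c : ℤ, ∀ b : Fin n → ℤ, c < |b i| →
    Function.Bijective
      (f (le_add_of_nonneg_right (Pi.single_nonneg.mpr zero_le_one)) :
        N b →ₗ[k] N (b + Pi.single i 1))

theorem mem_upFlat {n : ℕ} {a q : Fin n → ℤ} {τ : Set (Fin n)} :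
    q ∈ upFlat a τ ↔ ∀ i, i ∉ τ → a i ≤ q i := by
  classical
  simp only [upFlat, ZTau, NNn, Set.mem_add, Set.mem_singleton_iff, Set.mem_ofPred_eq]
  constructor
  · rintro ⟨_, ⟨_, rfl, z, hz, rfl⟩, m, hm, rfl⟩ i hi
    have := hm i
    simp only [Pi.add_apply, hz i hi, Pi.zero_apply] at this ⊢
    omega
  · intro h
    refine ⟨_, ⟨a, rfl, fun i => if i ∈ τ then q i - a i else 0, fun i hi => if_neg hi, rfl⟩,
      fun i => if i ∈ τ then 0 else q i - a i, fun i => ?_, funext fun i => ?_⟩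
    · by_cases hi : i ∈ τ
      · simp [hi]
      · simpa [hi] using h i hi
    · by_cases hi : i ∈ τ <;> simp [hi]

theorem mem_downInj {n : ℕ} {b q : Fin n → ℤ} {τ : Set (Fin n)} :
    q ∈ downInj b τ ↔ ∀ i, i ∉ τ → q i ≤ b i := by
  classical
  simp only [downInj, ZTau, NNn, Set.mem_add, Set.mem_sub, Set.mem_singleton_iff,
    Set.mem_ofPred_eq]
  constructor
  · rintro ⟨_, ⟨_, rfl, z, hz, rfl⟩, m, hm, rfl⟩ i hi
    have := hm i
    simp only [Pi.add_apply, Pi.sub_apply, hz i hi, Pi.zero_apply] at this ⊢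
    omega
  · intro h
    refine ⟨_, ⟨b, rfl, fun i => if i ∈ τ then q i - b i else 0, fun i hi => if_neg hi, rfl⟩,
      fun i => if i ∈ τ then 0 else b i - q i, fun i => ?_, funext fun i => ?_⟩
    · by_cases hi : i ∈ τ
      · simp [hi]
      · simpa [hi] using h i hi
    · by_cases hi : i ∈ τ <;> simp [hi]

section Indicator

variable {k : Type} [Field k] {Q : Type}

theorem cmpt_of_mem {S : Set Q} {q : Q} (h : q ∈ S) : cmpt k S q = ⊤ := by
  simp [cmpt, h]

theorem cmpt_of_notMem {S : Set Q} {q : Q} (h : q ∉ S) : cmpt k S q = ⊥ := by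
  simp [cmpt, h]

theorem cmpt_coe_of_notMem {S : Set Q} {q : Q} (h : q ∉ S) (x : cmpt k S q) : (x : k) = 0 := by
  simpa only [cmpt_of_notMem h, Submodule.mem_bot] using SetLike.coe_mem x

variable [PartialOrder Q]

theorem stMap_coe_of_mem {S : Set Q} {q q' : Q} (h : q ≤ q') (hq : q ∈ S) (hq' : q' ∈ S)
    (x : cmpt k S q) : (stMap k S h x : k) = x := by
  simp [stMap, hq, hq']

theorem stMap_coe_of_imp {S : Set Q} {q q' : Q} (h : q ≤ q') (hS : q ∈ S → q' ∈ S)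
    (x : cmpt k S q) : (stMap k S h x : k) = x := by
  by_cases hq : q ∈ S
  · exact stMap_coe_of_mem h hq (hS hq) x
  · simp [stMap, hq, cmpt_coe_of_notMem hq x]

theorem stMap_bijective {S : Set Q} {q q' : Q} (h : q ≤ q') (hS : q ∈ S ↔ q' ∈ S) :
    Function.Bijective (stMap k S h) := by
  have key := stMap_coe_of_imp (k := k) h hS.1
  refine ⟨fun x y hxy => Subtype.ext ?_, fun y => ⟨⟨y, ?_⟩, Subtype.ext (key _)⟩⟩
  · rw [← key x, ← key y, hxy]
  · by_cases hq : q ∈ S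
    · simp [cmpt_of_mem hq]
    · rw [cmpt_coe_of_notMem (fun hq' => hq (hS.2 hq')) y]
      exact zero_mem _

end Indicator

theorem FSumMap_bijective {k : Type} [Field k] {n m : ℕ} {a : Fin m → (Fin n → ℤ)}
    {τ : Fin m → Set (Fin n)} {q q' : Fin n → ℤ} (h : q ≤ q')
    (hS : ∀ p, q ∈ upFlat (a p) (τ p) ↔ q' ∈ upFlat (a p) (τ p)) :
    Function.Bijective (FSumMap k m a τ h) :=
  Function.Bijective.piMap fun p => stMap_bijective h (hS p)

theorem ESumMap_apply {k : Type} [Field k] {n m : ℕ} {b : Fin m → (Fin n → ℤ)}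
    {τ : Fin m → Set (Fin n)} {q q' : Fin n → ℤ} (h : q ≤ q') (x : ESum k m b τ q) (j : Fin m) :
    ESumMap k m b τ h x j = stMap k (downInj (b j) (τ j)) h (x j) :=
  rfl

theorem ESumMap_bijective {k : Type} [Field k] {n m : ℕ} {b : Fin m → (Fin n → ℤ)}
    {τ : Fin m → Set (Fin n)} {q q' : Fin n → ℤ} (h : q ≤ q')
    (hS : ∀ p, q ∈ downInj (b p) (τ p) ↔ q' ∈ downInj (b p) (τ p)) :
    Function.Bijective (ESumMap k m b τ h) :=
  Function.Bijective.piMap fun p => stMap_bijective h (hS p)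

theorem mem_upFlat_add_single_iff {n : ℕ} {a q : Fin n → ℤ} {τ : Set (Fin n)} {i : Fin n}
    (h : |a i| + 1 < |q i|) :
    q ∈ upFlat a τ ↔ q + Pi.single i 1 ∈ upFlat a τ := by
  simp only [mem_upFlat]
  refine forall₂_congr fun j _ => ?_
  obtain rfl | hj := eq_or_ne j i
  · simp only [Pi.add_apply, Pi.single_eq_same]
    grind
  · simp [hj]

theorem mem_downInj_add_single_iff {n : ℕ} {b q : Fin n → ℤ} {τ : Set (Fin n)} {i : Fin n}
    (h : |b i| < |q i|) :
    q ∈ downInj b τ ↔ q + Pi.single i 1 ∈ downInj b τ := by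
  simp only [mem_downInj]
  refine forall₂_congr fun j _ => ?_
  obtain rfl | hj := eq_or_ne j i
  · simp only [Pi.add_apply, Pi.single_eq_same]
    grind
  · simp [hj]

/-- Truncation of a vector to the box with corners `lo` and `hi`. -/
def clampBox {n : ℕ} (lo hi q : Fin n → ℤ) : Fin n → ℤ := (q ⊔ lo) ⊓ hi

section Clamp

variable {n : ℕ} {lo hi : Fin n → ℤ}

theorem clampBox_mono (lo hi : Fin n → ℤ) : Monotone (clampBox lo hi) :=
  fun _ _ h => inf_le_inf_right _ (sup_le_sup_right h _)

theorem clampBox_le (lo hi q : Fin n → ℤ) : clampBox lo hi q ≤ q ⊔ lo :=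
  inf_le_left

theorem clampBox_mem (h : lo ≤ hi) (q : Fin n → ℤ) : clampBox lo hi q ∈ Set.Icc lo hi :=
  ⟨le_inf le_sup_right h, inf_le_right⟩

theorem mem_upFlat_iff_le_clampBox {a q : Fin n → ℤ} (ha : a ∈ Set.Icc lo hi) :
    q ∈ upFlat a {i | a i = lo i} ↔ a ≤ clampBox lo hi q := by
  simp only [mem_upFlat, Pi.le_def, clampBox, Set.mem_ofPred_eq, Pi.sup_apply, le_inf_iff,
    le_sup_iff, ← forall_and]
  refine forall_congr' fun i => ?_
  have h1 : lo i ≤ a i := ha.1 i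
  have h2 : a i ≤ hi i := ha.2 i
  omega

theorem mem_downInj_iff_clampBox_le {b q : Fin n → ℤ} (hb : b ∈ Set.Icc lo hi) :
    q ∈ downInj b {i | b i = hi i} ↔ clampBox lo hi q ≤ b := by
  simp only [mem_downInj, Pi.le_def, clampBox, Set.mem_ofPred_eq, Pi.inf_apply, Pi.sup_apply,
    inf_le_iff, sup_le_iff]
  refine forall_congr' fun i => ?_
  have h1 : lo i ≤ b i := hb.1 i
  have h2 : b i ≤ hi i := hb.2 i
  omega

end Clamp

section PersistenceModule

variable {k : Type} [Field k] {n : ℕ}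
  {N : (Fin n → ℤ) → Type} [∀ a, AddCommGroup (N a)] [∀ a, Module k (N a)]
  {f : ∀ {a b : Fin n → ℤ}, a ≤ b → (N a →ₗ[k] N b)}

/-- A structure map is bijective if it can be traversed by unit steps that are bijective. -/
theorem bijective_of_steps
    (f_id : ∀ a : Fin n → ℤ, f (le_refl a) = LinearMap.id)
    (f_comp : ∀ {a b c : Fin n → ℤ} (h : a ≤ b) (h' : b ≤ c), f h' ∘ₗ f h = f (h.trans h'))
    {P : Fin n → ℤ → Prop}
    (hP : ∀ i b, P i (b i) → Function.Bijective
      (f (le_add_of_nonneg_right (Pi.single_nonneg.mpr zero_le_one)) :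
        N b →ₗ[k] N (b + Pi.single i 1)))
    {q q' : Fin n → ℤ} (h : q ≤ q') (hq : ∀ i z, q i ≤ z → z < q' i → P i z) :
    Function.Bijective (f h) := by
  obtain ⟨m, hm⟩ : ∃ m : ℕ, ∑ i, (q' i - q i) = m :=
    Int.eq_ofNat_of_zero_le (Finset.sum_nonneg fun i _ => sub_nonneg.2 (h i))
  induction m generalizing q with
  | zero =>
    have hz := (Finset.sum_eq_zero_iff_of_nonneg
      (fun i _ => sub_nonneg.2 (h i))).1 (hm.trans Nat.cast_zero)
    obtain rfl : q' = q := funext fun i => sub_eq_zero.1 (hz i (Finset.mem_univ i))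
    rw [f_id]
    exact Function.bijective_id
  | succ m ih =>
    obtain ⟨i, hi⟩ : ∃ i, q i < q' i := by
      by_contra! hcon
      have : ∑ i, (q' i - q i) ≤ 0 :=
        Finset.sum_nonpos fun i _ => sub_nonpos.2 (hcon i)
      push_cast at hm
      omega
    have hle : q + Pi.single i 1 ≤ q' := by
      intro j
      obtain rfl | hj := eq_or_ne j i
      · simpa using hi
      · simpa [hj] using h j
    have hstep : q ≤ q + Pi.single i 1 :=
      le_add_of_nonneg_right (Pi.single_nonneg.mpr zero_le_one)
    rw [← f_comp hstep hle, LinearMap.coe_comp]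
    refine (ih hle (fun j z hz hz' => hq j z ((hstep j).trans hz) hz') ?_).comp
      (hP i q (hq i _ le_rfl hi))
    simp only [Pi.add_apply, sub_add_eq_sub_sub, Finset.sum_sub_distrib,
      Finset.sum_pi_single', Finset.mem_univ, if_true] at hm ⊢
    push_cast at hm
    omega

/-- If the structure maps outside of the box are bijective, the module is isomorphic to the
pullback along truncation of its restriction to the box. -/
theorem exists_equiv_clampBox
    (f_comp : ∀ {a b c : Fin n → ℤ} (h : a ≤ b) (h' : b ≤ c), f h' ∘ₗ f h = f (h.trans h'))
    {lo hi : Fin n → ℤ}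
    (hlo : ∀ q : Fin n → ℤ, Function.Bijective (f (le_sup_left : q ≤ q ⊔ lo)))
    (hhi : ∀ q : Fin n → ℤ, Function.Bijective (f (clampBox_le lo hi q))) :
    ∃ θ : ∀ q, N q ≃ₗ[k] N (clampBox lo hi q), ∀ (q q' : Fin n → ℤ) (h : q ≤ q') (x : N q),
      θ q' (f h x) = f (clampBox_mono lo hi h) (θ q x) := by
  have hc : ∀ {a b c : Fin n → ℤ} (h : a ≤ b) (h' : b ≤ c) (x : N a),
      f h' (f h x) = f (h.trans h') x := fun h h' x => LinearMap.congr_fun (f_comp h h') x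
  let B : ∀ q, N (clampBox lo hi q) ≃ₗ[k] N (q ⊔ lo) := fun q =>
    LinearEquiv.ofBijective (f (clampBox_le lo hi q)) (hhi q)
  have hB : ∀ q y, B q y = f (clampBox_le lo hi q) y := fun _ _ => rfl
  refine ⟨fun q => (LinearEquiv.ofBijective _ (hlo q)).trans (B q).symm, fun q q' h x => ?_⟩
  simp only [LinearEquiv.trans_apply, LinearEquiv.ofBijective_apply]
  obtain ⟨y, hy⟩ := (B q).surjective (f (le_sup_left : q ≤ q ⊔ lo) x)
  rw [LinearEquiv.symm_apply_eq, ← hy, LinearEquiv.symm_apply_apply, hB, hc, hc,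
    ← hc (le_sup_left : q ≤ q ⊔ lo) (sup_le_sup_right h lo), ← hy, hB, hc]

/-- Truncation to the box admits a surjection from a finite direct sum of upset modules. -/
theorem exists_surjective_FSum [∀ a, FiniteDimensional k (N a)]
    (f_id : ∀ a : Fin n → ℤ, f (le_refl a) = LinearMap.id)
    (f_comp : ∀ {a b c : Fin n → ℤ} (h : a ≤ b) (h' : b ≤ c), f h' ∘ₗ f h = f (h.trans h'))
    {lo hi : Fin n → ℤ} (hle : lo ≤ hi) :
    ∃ (m : ℕ) (a : Fin m → (Fin n → ℤ)) (τ : Fin m → Set (Fin n))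
      (g : ∀ q, FSum k m a τ q →ₗ[k] N (clampBox lo hi q)),
      (∀ q, Function.Surjective (g q)) ∧
      ∀ (q q' : Fin n → ℤ) (h : q ≤ q') (x : FSum k m a τ q),
        g q' (FSumMap k m a τ h x) = f (clampBox_mono lo hi h) (g q x) := by
  classical
  let ι := Σ a : Set.Icc lo hi, Fin (Module.finrank k (N a))
  let ε : Fin (Fintype.card ι) ≃ ι := (Fintype.equivFin ι).symm
  let s : ∀ (p : ι) (r : Fin n → ℤ), N r := fun p r =>
    if h : p.1.1 ≤ r then f h (Module.finBasis k (N p.1.1) p.2) else 0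
  let a : Fin (Fintype.card ι) → (Fin n → ℤ) := fun p => (ε p).1.1
  let τ : Fin (Fintype.card ι) → Set (Fin n) := fun p => {i | a p i = lo i}
  have hmem : ∀ p q, q ∈ upFlat (a p) (τ p) ↔ a p ≤ clampBox lo hi q := fun p q =>
    mem_upFlat_iff_le_clampBox (ε p).1.2
  have hsf : ∀ (p : ι) {r r' : Fin n → ℤ} (h : r ≤ r'), p.1.1 ≤ r → f h (s p r) = s p r' := by
    intro p r r' h hp
    simp only [s, dif_pos hp, dif_pos (hp.trans h)]
    exact LinearMap.congr_fun (f_comp hp h) _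
  refine ⟨_, a, τ, fun q => ∑ p, (LinearMap.toSpanSingleton k _ (s (ε p) (clampBox lo hi q))) ∘ₗ
    (Submodule.subtype _) ∘ₗ LinearMap.proj p, fun q => ?_, fun q q' h x => ?_⟩
  · rw [← LinearMap.range_eq_top, eq_top_iff,
      ← (Module.finBasis k (N (clampBox lo hi q))).span_eq, Submodule.span_le]
    rintro _ ⟨t, rfl⟩
    let p : ι := ⟨⟨clampBox lo hi q, clampBox_mem hle q⟩, t⟩
    have hq : q ∈ upFlat (a (ε.symm p)) (τ (ε.symm p)) := by
      rw [hmem]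
      simp [a, p]
    refine ⟨Pi.single (ε.symm p) ⟨1, by simp [cmpt_of_mem hq]⟩, ?_⟩
    rw [LinearMap.sum_apply, Finset.sum_eq_single (ε.symm p)]
    · simp [s, p, f_id]
    · intro b _ hb
      simp [hb]
    · simp
  · simp only [LinearMap.sum_apply, map_sum]
    refine Finset.sum_congr rfl fun p _ => ?_
    have hx : (FSumMap k _ a τ h x p : k) = x p :=
      stMap_coe_of_imp h (fun hq => (hmem p q').2
        (((hmem p q).1 hq).trans (clampBox_mono lo hi h))) (x p)
    simp only [LinearMap.comp_apply, LinearMap.proj_apply, Submodule.subtype_apply,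
      LinearMap.toSpanSingleton_apply, hx, map_smul]
    by_cases hq : q ∈ upFlat (a p) (τ p)
    · rw [hsf _ _ ((hmem p q).1 hq)]
    · rw [cmpt_coe_of_notMem hq (x p), zero_smul, zero_smul]

/-- Truncation to the box admits an injection into a finite direct sum of downset modules. -/
theorem exists_injective_ESum [∀ a, FiniteDimensional k (N a)]
    (f_id : ∀ a : Fin n → ℤ, f (le_refl a) = LinearMap.id)
    (f_comp : ∀ {a b c : Fin n → ℤ} (h : a ≤ b) (h' : b ≤ c), f h' ∘ₗ f h = f (h.trans h'))
    {lo hi : Fin n → ℤ} (hle : lo ≤ hi) :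
    ∃ (m : ℕ) (b : Fin m → (Fin n → ℤ)) (τ : Fin m → Set (Fin n))
      (g : ∀ q, N (clampBox lo hi q) →ₗ[k] ESum k m b τ q),
      (∀ q, Function.Injective (g q)) ∧
      ∀ (q q' : Fin n → ℤ) (h : q ≤ q') (x : N (clampBox lo hi q)),
        g q' (f (clampBox_mono lo hi h) x) = ESumMap k m b τ h (g q x) := by
  classical
  let ι := Σ a : Set.Icc lo hi, Fin (Module.finrank k (N a))
  let ε : Fin (Fintype.card ι) ≃ ι := (Fintype.equivFin ι).symm
  let s : ∀ (p : ι) (r : Fin n → ℤ), N r →ₗ[k] k := fun p r =>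
    if h : r ≤ p.1.1 then (Module.finBasis k (N p.1.1)).coord p.2 ∘ₗ f h else 0
  let b : Fin (Fintype.card ι) → (Fin n → ℤ) := fun p => (ε p).1.1
  let τ : Fin (Fintype.card ι) → Set (Fin n) := fun p => {i | b p i = hi i}
  have hmem : ∀ p q, q ∈ downInj (b p) (τ p) ↔ clampBox lo hi q ≤ b p := fun p q =>
    mem_downInj_iff_clampBox_le (ε p).1.2
  have hsf : ∀ (p : ι) {r r' : Fin n → ℤ} (h : r ≤ r') (x : N r), r' ≤ p.1.1 →
      s p r' (f h x) = s p r x := by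
    intro p r r' h x hp
    simp only [s, dif_pos hp, dif_pos (h.trans hp), LinearMap.comp_apply]
    rw [← f_comp h hp, LinearMap.comp_apply]
  have hs0 : ∀ (p : ι) {r : Fin n → ℤ}, ¬ r ≤ p.1.1 → s p r = 0 := fun p _ h => dif_neg h
  have hs1 : ∀ (p : ι) (x : N p.1.1),
      s p p.1.1 x = (Module.finBasis k (N p.1.1)).repr x p.2 := fun p x => by
    simp [s, f_id]
  refine ⟨_, b, τ, fun q => LinearMap.pi fun p =>
    (s (ε p) (clampBox lo hi q)).codRestrict _ fun x => ?_, fun q => ?_, fun q q' h x => ?_⟩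
  · by_cases hq : q ∈ downInj (b p) (τ p)
    · simp [cmpt_of_mem hq]
    · rw [hs0 _ (fun hp => hq ((hmem p q).2 hp)), LinearMap.zero_apply]
      exact zero_mem _
  · rw [← LinearMap.ker_eq_bot, LinearMap.ker_eq_bot']
    intro x hx
    refine (Module.finBasis k (N (clampBox lo hi q))).ext_elem fun t => ?_
    let p : ι := ⟨⟨clampBox lo hi q, clampBox_mem hle q⟩, t⟩
    have hp : s (ε (ε.symm p)) (clampBox lo hi q) x = 0 :=
      congrArg Subtype.val (congrFun hx (ε.symm p))
    rw [Equiv.apply_symm_apply] at hp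
    rw [map_zero, Finsupp.zero_apply, ← hp]
    exact (hs1 p x).symm
  · refine funext fun p => Subtype.ext ?_
    by_cases hq' : q' ∈ downInj (b p) (τ p)
    · have hp := (hmem p q').1 hq'
      rw [ESumMap_apply, stMap_coe_of_mem h
        ((hmem p q).2 ((clampBox_mono lo hi h).trans hp)) hq']
      exact hsf (ε p) _ x hp
    · rw [cmpt_coe_of_notMem hq', cmpt_coe_of_notMem hq']

end PersistenceModule

/-- A `ℤⁿ`-module `N` is finitely determined if and only if it admits a
finite flange presentation: a homomorphism `φ : F → E` of `ℤⁿ`-modules with image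
isomorphic to `N`, where `F` is a finite direct sum of upset modules `k[a + ℤτ' + ℕⁿ]`
and `E` is a finite direct sum of downset modules `k[b + ℤτ − ℕⁿ]`. -/
theorem finitely_determined_iff_finite_flange_presentation
    (k : Type) [Field k] (n : ℕ)
    (N : (Fin n → ℤ) → Type) [∀ a, AddCommGroup (N a)] [∀ a, Module k (N a)]
    (f : ∀ {a b : Fin n → ℤ}, a ≤ b → (N a →ₗ[k] N b))
    (f_id : ∀ a : Fin n → ℤ, f (le_refl a) = LinearMap.id)
    (f_comp : ∀ {a b c : Fin n → ℤ} (h : a ≤ b) (h' : b ≤ c),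
      f h' ∘ₗ f h = f (h.trans h')) :
    FinDet k N (fun {a b} h => f h) ↔
    ∃ (mF mE : ℕ) (av : Fin mF → (Fin n → ℤ)) (τ'v : Fin mF → Set (Fin n))
      (bv : Fin mE → (Fin n → ℤ)) (τv : Fin mE → Set (Fin n))
      (φ : ∀ q : Fin n → ℤ, FSum k mF av τ'v q →ₗ[k] ESum k mE bv τv q),
      -- φ is a homomorphism of ℤⁿ-modules
      (∀ (q q' : Fin n → ℤ) (h : q ≤ q'),
        ESumMap k mE bv τv h ∘ₗ φ q = φ q' ∘ₗ FSumMap k mF av τ'v h) ∧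
      -- with image isomorphic to N as a ℤⁿ-module
      ∃ e : ∀ q : Fin n → ℤ, N q ≃ₗ[k] ↥(LinearMap.range (φ q)),
        ∀ (q q' : Fin n → ℤ) (h : q ≤ q') (x : N q),
          ((e q' (f h x)) : ESum k mE bv τv q')
            = ESumMap k mE bv τv h ((e q x : ESum k mE bv τv q)) := by
  constructor
  · rintro ⟨hfin, hdet⟩
    choose c hc using hdet
    let lo : Fin n → ℤ := fun i => -|c i|
    let hi : Fin n → ℤ := fun i => |c i| + 1
    have hle : lo ≤ hi := fun i => by
      have := abs_nonneg (c i)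
      simp only [lo, hi]
      omega
    have hP : ∀ {q q' : Fin n → ℤ} (h : q ≤ q'),
        (∀ i z, q i ≤ z → z < q' i → c i < |z|) → Function.Bijective (f h) := fun h =>
      bijective_of_steps f_id f_comp (P := fun i z => c i < |z|) hc h
    obtain ⟨θ, hθ⟩ := exists_equiv_clampBox (f := f) f_comp (lo := lo) (hi := hi)
      (fun q => hP _ fun i z h1 h2 => by
        simp only [Pi.sup_apply, lt_sup_iff, lo] at h2
        grind)
      (fun q => hP _ fun i z h1 h2 => by
        simp only [clampBox, Pi.inf_apply, Pi.sup_apply, inf_le_iff, sup_le_iff, lt_sup_iff,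
          lo, hi] at h1 h2
        grind)
    obtain ⟨mF, a, τ', g, hg, hgn⟩ := exists_surjective_FSum f_id f_comp hle
    obtain ⟨mE, b, τ, j, hj, hjn⟩ := exists_injective_ESum f_id f_comp hle
    have hr : ∀ q, LinearMap.range (j q ∘ₗ (θ q).toLinearMap) = LinearMap.range (j q ∘ₗ g q) := by
      intro q
      rw [LinearMap.range_comp_of_range_eq_top _ (LinearEquiv.range _),
        LinearMap.range_comp_of_range_eq_top _ (LinearMap.range_eq_top.2 (hg q))]
    refine ⟨mF, mE, a, τ', b, τ, fun q => j q ∘ₗ g q, fun q q' h => ?_,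
      fun q => (LinearEquiv.ofInjective (j q ∘ₗ (θ q).toLinearMap)
        ((hj q).comp (θ q).injective)).trans (LinearEquiv.ofEq _ _ (hr q)), fun q q' h x => ?_⟩
    · refine LinearMap.ext fun x => ?_
      simp only [LinearMap.comp_apply]
      rw [hgn, hjn]
    · change j q' (θ q' (f h x)) = ESumMap k mE b τ h (j q (θ q x))
      rw [hθ, hjn]
  · rintro ⟨mF, mE, a, τ', b, τ, φ, hφ, e, he⟩
    refine ⟨fun q => Module.Finite.equiv (e q).symm, fun i => ?_⟩
    have hpos : ∀ {m : ℕ} (v : Fin m → (Fin n → ℤ)) (p : Fin m), |v p i| ≤ ∑ p, |v p i| :=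
      fun v p => Finset.single_le_sum (f := fun p => |v p i|) (fun _ _ => abs_nonneg _)
        (Finset.mem_univ p)
    refine ⟨(∑ p, |a p i|) + (∑ p, |b p i|) + 1, fun q hq => ?_⟩
    have ha0 : 0 ≤ ∑ p, |a p i| := Finset.sum_nonneg fun _ _ => abs_nonneg _
    have hb0 : 0 ≤ ∑ p, |b p i| := Finset.sum_nonneg fun _ _ => abs_nonneg _
    have hstep : q ≤ q + Pi.single i 1 :=
      le_add_of_nonneg_right (Pi.single_nonneg.mpr zero_le_one)
    have hF := FSumMap_bijective (k := k) (a := a) (τ := τ') hstep fun p =>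
      mem_upFlat_add_single_iff (by have := hpos a p; omega)
    have hE := ESumMap_bijective (k := k) (b := b) (τ := τ) hstep fun p =>
      mem_downInj_add_single_iff (by have := hpos b p; omega)
    refine ⟨fun x y hxy => ?_, fun y => ?_⟩
    · refine (e q).injective (Subtype.ext (hE.1 ?_))
      rw [← he, ← he, hxy]
    · obtain ⟨z, hz⟩ := (e _ y).2
      obtain ⟨w, rfl⟩ := hF.2 z
      obtain ⟨x, hx⟩ := (e q).surjective ⟨φ q w, w, rfl⟩
      refine ⟨x, (e _).injective (Subtype.ext ?_)⟩
      rw [he, hx, ← hz]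
      exact LinearMap.congr_fun (hφ _ _ hstep) w
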